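/- Let C_0 ≥ 0. Suppose the hyperplanes in 𝒜 are pairwise non-parallel and ‖F(A)‖ > C_0 for every A ∈ 𝒜. Then for every k with 1 ≤ k ≤ n such that δ_k ∈ (0, 1/2], w_k(B_k) ≤ (1/(4 δ_k (1−δ_k) |S_k|²)) · ∑_{F_1, F_2 ⊆ {1,…,k−1}, ‖F_1‖ > C_0/|S_k|, ‖F_2‖ > C_0/|S_k|} ∏_{j ∈ F_1 ∪ F_2} 1/((1−δ_j)|S_j|). -/

import Mathlib

open Finset
open scoped Classical

/-- A hyperplane in `S_1 × ⋯ × S_n`.  Coordinates are 0-indexed in Lean: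
coordinate `j : ℕ`, `j < n`, corresponds to the paper's coordinate `j + 1`,
so the paper's set `S_j` is `S (j - 1)` here.  A hyperplane is recorded by its
finite set `F` of fixed coordinates together with the fixed value at each
fixed coordinate (on the non-fixed coordinates it is all of `S j`). -/
structure Hyp (S : ℕ → Type) (n : ℕ) where
  F : Finset ℕ
  hF : ∀ j ∈ F, j < n
  val : ∀ j ∈ F, S j

/-- The stage of a hyperplane: in the paper's 1-based labelling,
`A.stage = max F(A)`; in the 0-based labelling it is `(sup of A.F) + 1`. -/
def Hyp.stage {S : ℕ → Type} {n : ℕ} (A : Hyp S n) : ℕ := A.F.sup id + 1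

/-- `Qp S k` is the paper's `Q_k = S_1 × ⋯ × S_k` (in 0-based indexing,
`S 0 × ⋯ × S (k-1)`).  `Qp S 0` is a one-element type. -/
abbrev Qp (S : ℕ → Type) (k : ℕ) := ∀ j : Fin k, S j

/-- `x ∈ Q_k` lies on (the projection to `Q_k` of) the hyperplane `A`;
this is the correct notion of membership whenever `F(A) ⊆ {1, …, k}`. -/
def memH {S : ℕ → Type} {n : ℕ} (A : Hyp S n) {k : ℕ} (x : Qp S k) : Prop :=
  ∀ (j : Fin k) (h : (j : ℕ) ∈ A.F), x j = A.val j h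

/-- Membership in `B_k = ⋃_{A ∈ 𝒜_k} A`, viewed as a subset of `Q_k`, where
`𝒜_k = {A ∈ 𝒜 : max F(A) = k}` (1-based `k`). -/
def memB {S : ℕ → Type} {n : ℕ} {ι : Type} (𝓐 : ι → Hyp S n) (k : ℕ) (x : Qp S k) : Prop :=
  ∃ i, (𝓐 i).stage = k ∧ memH (𝓐 i) x

/-- `alpha 𝓐 k x` is the paper's `α_{k+1}(x)` for `x ∈ Q_k`: the proportion of
the fiber `F_x` covered by `B_{k+1}`. -/
noncomputable def alpha {S : ℕ → Type} [∀ j, Fintype (S j)] {n : ℕ} {ι : Type}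
    (𝓐 : ι → Hyp S n) (k : ℕ) (x : Qp S k) : ℝ :=
  ((univ.filter fun y : S k => memB 𝓐 (k + 1) (Fin.snoc x y)).card : ℝ) /
    (Fintype.card (S k))

/-- The weights `w_k : Q_k → ℝ`, defined inductively:  `w_0 ≡ 1`, and `w_(k+1)`
is obtained from `w_k` by the distortion rule with parameter `δ_{k+1} = δ k`.
(The paper's `δ_j` is `δ (j - 1)` here.) -/
noncomputable def w {S : ℕ → Type} [∀ j, Fintype (S j)] {n : ℕ} {ι : Type}
    (𝓐 : ι → Hyp S n) (δ : ℕ → ℝ) : (k : ℕ) → Qp S k → ℝ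
  | 0, _ => 1
  | (k + 1), x =>
      let x' : Qp S k := fun j => x j.castSucc
      let a : ℝ := alpha 𝓐 k x'
      if memB 𝓐 (k + 1) x then
        if a ≤ δ k then 0
        else ((a - δ k) / (a * (1 - δ k))) * (w 𝓐 δ k x' / (Fintype.card (S k)))
      else
        if a ≤ δ k then (1 / (1 - a)) * (w 𝓐 δ k x' / (Fintype.card (S k)))
        else (1 / (1 - δ k)) * (w 𝓐 δ k x' / (Fintype.card (S k)))

/-- `w_k(B_k)` (1-based `k`). -/
noncomputable def wB {S : ℕ → Type} [∀ j, Fintype (S j)] {n : ℕ} {ι : Type}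
    (𝓐 : ι → Hyp S n) (δ : ℕ → ℝ) (k : ℕ) : ℝ :=
  ∑ x ∈ univ.filter (memB 𝓐 k), w 𝓐 δ k x

/-- `w_k(A)`: the weight of the projection to `Q_k` of a hyperplane `A`
(meaningful when `F(A) ⊆ {1, …, k}`). -/
noncomputable def wH {S : ℕ → Type} [∀ j, Fintype (S j)] {n : ℕ} {ι : Type}
    (𝓐 : ι → Hyp S n) (δ : ℕ → ℝ) (k : ℕ) (A : Hyp S n) : ℝ :=
  ∑ x ∈ univ.filter (fun x : Qp S k => memH A x), w 𝓐 δ k x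

/-- `ν(J) = ∏_{j ∈ J} 1 / ((1 - δ_j)|S_j|)` (0-based `J`). -/
noncomputable def nu (S : ℕ → Type) [∀ j, Fintype (S j)] (δ : ℕ → ℝ) (J : Finset ℕ) : ℝ :=
  ∏ j ∈ J, 1 / ((1 - δ j) * (Fintype.card (S j)))

/-- `‖J‖ = ∏_{j ∈ J} |S_j|` (0-based `J`). -/
noncomputable def normJ (S : ℕ → Type) [∀ j, Fintype (S j)] (J : Finset ℕ) : ℝ :=
  ∏ j ∈ J, (Fintype.card (S j) : ℝ)

/-- `Ew 𝓐 δ k` is the paper's `E_k = E_{(k+1)-1} = ∑_{x ∈ Q_k} α_{k+1}(x)² w_k(x)`. -/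
noncomputable def Ew {S : ℕ → Type} [∀ j, Fintype (S j)] {n : ℕ} {ι : Type}
    (𝓐 : ι → Hyp S n) (δ : ℕ → ℝ) (k : ℕ) : ℝ :=
  ∑ x : Qp S k, (alpha 𝓐 k x) ^ 2 * w 𝓐 δ k x

section Hyperplanes

variable {S : ℕ → Type} {n : ℕ}

lemma memH_snoc {A : Hyp S n} {k : ℕ} {x : Qp S k} {y : S k} :
    memH A (k := k + 1) (Fin.snoc x y) ↔ memH A x ∧ ∀ h : k ∈ A.F, y = A.val k h := by
  simp [memH, Fin.forall_fin_succ']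

lemma Hyp.mem_F_of_stage_eq {A : Hyp S n} (hA : A.F.Nonempty) {k : ℕ} (h : A.stage = k + 1) :
    k ∈ A.F := by
  obtain ⟨j, hj, hj'⟩ := exists_mem_eq_sup A.F hA id
  have : j = k := by simp only [Hyp.stage, hj', id] at h; omega
  exact this ▸ hj

lemma Hyp.filter_lt_of_stage_eq {A : Hyp S n} {k : ℕ} (h : A.stage = k + 1) :
    A.F.filter (· < k) = A.F.erase k := by
  ext j
  rw [mem_filter, mem_erase, and_comm (a := j ≠ k)]
  refine and_congr_right fun hj => ?_
  have : j ≤ A.F.sup id := le_sup (f := id) hj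
  simp only [Hyp.stage] at h
  omega

end Hyperplanes

section Distortion

variable {S : ℕ → Type} [∀ j, Fintype (S j)] {n : ℕ} {ι : Type} {𝓐 : ι → Hyp S n} {δ : ℕ → ℝ}

lemma sum_snoc (k : ℕ) (f : Qp S (k + 1) → ℝ) :
    ∑ x, f x = ∑ x : Qp S k, ∑ y : S k, f (Fin.snoc x y) := by
  rw [← (Fin.snocEquiv fun j : Fin (k + 1) => S j).sum_comp, Fintype.sum_prod_type_right]
  rfl

lemma w_snoc (k : ℕ) (x : Qp S k) (y : S k) :
    w 𝓐 δ (k + 1) (Fin.snoc x y) =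
      (if memB 𝓐 (k + 1) (Fin.snoc x y) then
        if alpha 𝓐 k x ≤ δ k then 0
        else (alpha 𝓐 k x - δ k) / (alpha 𝓐 k x * (1 - δ k))
      else if alpha 𝓐 k x ≤ δ k then 1 / (1 - alpha 𝓐 k x) else 1 / (1 - δ k)) *
        (w 𝓐 δ k x / Fintype.card (S k)) := by
  simp only [w, Fin.snoc_castSucc]
  split_ifs <;> simp

lemma alpha_nonneg (k : ℕ) (x : Qp S k) : 0 ≤ alpha 𝓐 k x := by
  unfold alpha; positivity

lemma alpha_le_one (k : ℕ) (x : Qp S k) : alpha 𝓐 k x ≤ 1 :=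
  div_le_one_of_le₀ (by exact_mod_cast card_le_univ _) (by positivity)

lemma w_nonneg (hδ : ∀ j < n, δ j ∈ Set.Icc (0 : ℝ) (1 / 2)) {k : ℕ} (hk : k ≤ n)
    (x : Qp S k) : 0 ≤ w 𝓐 δ k x := by
  induction k with
  | zero => simp [w]
  | succ k ih =>
    obtain ⟨hδ₀, hδ₁⟩ := hδ k hk
    induction x using Fin.snocCases with | _ x y
    have hα := alpha_nonneg (𝓐 := 𝓐) k x
    have hα' := alpha_le_one (𝓐 := 𝓐) k x
    rw [w_snoc]
    refine mul_nonneg ?_ (div_nonneg (ih (by omega) x) (by positivity))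
    split_ifs with _ h h
    · exact le_rfl
    · exact div_nonneg (by linarith) (mul_nonneg hα (by linarith))
    · exact div_nonneg zero_le_one (by linarith)
    · exact div_nonneg zero_le_one (by linarith)

lemma w_snoc_le (hδ : ∀ j < n, δ j ∈ Set.Icc (0 : ℝ) (1 / 2)) {k : ℕ} (hk : k < n)
    (x : Qp S k) (y : S k) :
    w 𝓐 δ (k + 1) (Fin.snoc x y) ≤ 1 / ((1 - δ k) * Fintype.card (S k)) * w 𝓐 δ k x := by
  obtain ⟨hδ₀, hδ₁⟩ := hδ k hk
  have hα := alpha_nonneg (𝓐 := 𝓐) k x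
  have hα' := alpha_le_one (𝓐 := 𝓐) k x
  have hδ' : 0 < 1 - δ k := by linarith
  have hw := w_nonneg (𝓐 := 𝓐) hδ hk.le x
  rw [w_snoc, show 1 / ((1 - δ k) * Fintype.card (S k)) * w 𝓐 δ k x =
    1 / (1 - δ k) * (w 𝓐 δ k x / Fintype.card (S k)) by rw [← one_div_mul_one_div]; ring]
  refine mul_le_mul_of_nonneg_right ?_ (by positivity)
  split_ifs with _ h h
  · positivity
  · have : 0 < alpha 𝓐 k x := by linarith
    rw [div_le_div_iff₀ (by positivity) hδ']
    nlinarith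
  · exact one_div_le_one_div_of_le hδ' (by linarith)
  · exact le_rfl

lemma sum_fiber (k : ℕ) (x : Qp S k) (hS : 0 < Fintype.card (S k)) (b c : ℝ) :
    ∑ y : S k, (if memB 𝓐 (k + 1) (Fin.snoc x y) then b else c) =
      Fintype.card (S k) * (alpha 𝓐 k x * b + (1 - alpha 𝓐 k x) * c) := by
  have hS' : (Fintype.card (S k) : ℝ) ≠ 0 := by positivity
  have hcard := card_filter_add_card_filter_not (s := univ)
    (fun y : S k => memB 𝓐 (k + 1) (Fin.snoc x y))
  rw [card_univ] at hcard
  have hcard' := congrArg (Nat.cast : ℕ → ℝ) hcard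
  push_cast at hcard'
  rw [sum_ite, sum_const, sum_const, nsmul_eq_mul, nsmul_eq_mul, alpha]
  field_simp
  linear_combination c * hcard'

lemma sum_w_snoc (hδ : ∀ j < n, δ j ∈ Set.Icc (0 : ℝ) (1 / 2)) {k : ℕ} (hk : k < n)
    (hS : 0 < Fintype.card (S k)) (x : Qp S k) :
    ∑ y : S k, w 𝓐 δ (k + 1) (Fin.snoc x y) = w 𝓐 δ k x := by
  obtain ⟨hδ₀, hδ₁⟩ := hδ k hk
  have hS' : (Fintype.card (S k) : ℝ) ≠ 0 := by positivity
  have hδ' : 1 - δ k ≠ 0 := by linarith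
  simp only [w_snoc]
  rw [← sum_mul, sum_fiber k x hS]
  split_ifs with h
  · have : 1 - alpha 𝓐 k x ≠ 0 := by linarith
    field_simp
    ring
  · have : alpha 𝓐 k x ≠ 0 := by linarith
    field_simp
    ring

lemma sum_w_agree_le (hS : ∀ j < n, 0 < Fintype.card (S j))
    (hδ : ∀ j < n, δ j ∈ Set.Icc (0 : ℝ) (1 / 2)) (J : Finset ℕ) {k : ℕ} (hk : k ≤ n)
    (z : Qp S k) :
    ∑ x : Qp S k, (if ∀ j : Fin k, (j : ℕ) ∈ J → x j = z j then w 𝓐 δ k x else 0) ≤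
      ∏ j ∈ range k, if j ∈ J then 1 / ((1 - δ j) * Fintype.card (S j)) else 1 := by
  induction k with
  | zero => simp [w]
  | succ k ih =>
    obtain ⟨hδ₀, hδ₁⟩ := hδ k hk
    induction z using Fin.snocCases with | _ z t
    rw [prod_range_succ, sum_snoc, mul_comm]
    simp only [Fin.forall_fin_succ', Fin.snoc_castSucc, Fin.snoc_last, Fin.val_castSucc,
      Fin.val_last]
    refine le_trans ?_ (mul_le_mul_of_nonneg_left (ih (by omega) z) ?_)
    · rw [mul_sum]
      refine sum_le_sum fun x _ => ?_
      by_cases hx : ∀ j : Fin k, (j : ℕ) ∈ J → x j = z j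
      · by_cases hkJ : k ∈ J
        · simp only [eq_true hx, hkJ, true_and, forall_const, if_true, sum_ite_eq',
            mem_univ]
          exact w_snoc_le hδ hk x t
        · simp [eq_true hx, hkJ, sum_w_snoc hδ hk (hS k hk)]
      · simp [hx]
    · split_ifs
      · exact div_nonneg zero_le_one (mul_nonneg (by linarith) (by positivity))
      · exact zero_le_one

lemma sum_w_memH_inter_le (hS : ∀ j < n, 0 < Fintype.card (S j))
    (hδ : ∀ j < n, δ j ∈ Set.Icc (0 : ℝ) (1 / 2)) {k : ℕ} (hk : k ≤ n) (A A' : Hyp S n) :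
    ∑ x : Qp S k, (if memH A x ∧ memH A' x then w 𝓐 δ k x else 0) ≤
      nu S δ ((A.F ∪ A'.F).filter (· < k)) := by
  by_cases hne : ∃ z : Qp S k, memH A z ∧ memH A' z
  · obtain ⟨z, hz, hz'⟩ := hne
    have hfilter : (A.F ∪ A'.F).filter (· < k) = (range k).filter (· ∈ A.F ∪ A'.F) := by
      ext j
      simp [and_comm]
    rw [nu, hfilter, prod_filter]
    refine le_trans (le_of_eq (sum_congr rfl fun x _ => ?_))
      (sum_w_agree_le (𝓐 := 𝓐) hS hδ (A.F ∪ A'.F) hk z)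
    refine if_congr ⟨?_, ?_⟩ rfl rfl
    · rintro ⟨h, h'⟩ j hj
      rcases mem_union.1 hj with hj | hj
      · rw [h j hj, hz j hj]
      · rw [h' j hj, hz' j hj]
    · intro h
      exact ⟨fun j hj => (h j (mem_union_left _ hj)).trans (hz j hj),
        fun j hj => (h j (mem_union_right _ hj)).trans (hz' j hj)⟩
  · push Not at hne
    rw [sum_eq_zero fun x _ => if_neg fun h => hne x h.1 h.2]
    refine prod_nonneg fun j hj => div_nonneg zero_le_one (mul_nonneg ?_ (by positivity))
    have := (hδ j ((mem_filter.1 hj).2.trans_le hk)).2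
    linarith

lemma alpha_le [Fintype ι] (hF : ∀ i, (𝓐 i).F.Nonempty) (k : ℕ) (x : Qp S k) :
    alpha 𝓐 k x ≤ (∑ i ∈ univ.filter (fun i => (𝓐 i).stage = k + 1),
      if memH (𝓐 i) x then (1 : ℝ) else 0) / Fintype.card (S k) := by
  rw [sum_boole, alpha]
  refine div_le_div_of_nonneg_right (Nat.cast_le.2 ?_) (by positivity)
  refine card_le_card_of_forall_subsingleton
    (fun y i => memH (𝓐 i) (k := k + 1) (Fin.snoc x y)) ?_ ?_
  · intro y hy
    obtain ⟨i, hi, hy⟩ := (mem_filter.1 hy).2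
    exact ⟨i, by simp [hi, (memH_snoc.1 hy).1], hy⟩
  · rintro i hi y ⟨-, hy⟩ y' ⟨-, hy'⟩
    have hk := Hyp.mem_F_of_stage_eq (hF i) (mem_filter.1 (mem_filter.1 hi).1).2
    rw [(memH_snoc.1 hy).2 hk, (memH_snoc.1 hy').2 hk]

lemma wB_le_Ew (hδ : ∀ j < n, δ j ∈ Set.Icc (0 : ℝ) (1 / 2)) {k : ℕ} (hk : k < n)
    (hS : 0 < Fintype.card (S k)) (hδk : 0 < δ k) :
    wB 𝓐 δ (k + 1) ≤ 1 / (4 * δ k * (1 - δ k)) * Ew 𝓐 δ k := by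
  obtain ⟨hδ₀, hδ₁⟩ := hδ k hk
  have hS' : (Fintype.card (S k) : ℝ) ≠ 0 := by positivity
  have hδ' : 0 < 1 - δ k := by linarith
  rw [wB, sum_filter, sum_snoc, Ew, mul_sum]
  refine sum_le_sum fun x _ => ?_
  have hα := alpha_nonneg (𝓐 := 𝓐) k x
  have hw := w_nonneg (𝓐 := 𝓐) hδ hk.le x
  have hfiber (y : S k) :
      (if memB 𝓐 (k + 1) (Fin.snoc x y) then w 𝓐 δ (k + 1) (Fin.snoc x y) else 0) =
      (if memB 𝓐 (k + 1) (Fin.snoc x y) then (if alpha 𝓐 k x ≤ δ k then 0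
        else (alpha 𝓐 k x - δ k) / (alpha 𝓐 k x * (1 - δ k))) else 0) *
        (w 𝓐 δ k x / Fintype.card (S k)) := by
    rw [w_snoc]
    split_ifs <;> simp
  simp only [hfiber]
  rw [← sum_mul, sum_fiber k x hS]
  split_ifs with h
  · simp only [mul_zero, add_zero, zero_mul]
    positivity
  · have hα' : alpha 𝓐 k x ≠ 0 := by linarith
    calc _ = (alpha 𝓐 k x - δ k) / (1 - δ k) * w 𝓐 δ k x := by field_simp; ring
      _ ≤ alpha 𝓐 k x ^ 2 / (4 * δ k * (1 - δ k)) * w 𝓐 δ k x := by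
        refine mul_le_mul_of_nonneg_right ?_ hw
        rw [div_le_div_iff₀ hδ' (by positivity)]
        nlinarith [mul_nonneg hδ'.le (sq_nonneg (alpha 𝓐 k x - 2 * δ k))]
      _ = _ := by ring

lemma Ew_le [Fintype ι] (hF : ∀ i, (𝓐 i).F.Nonempty) (hS : ∀ j < n, 0 < Fintype.card (S j))
    (hδ : ∀ j < n, δ j ∈ Set.Icc (0 : ℝ) (1 / 2)) {k : ℕ} (hk : k < n) :
    Ew 𝓐 δ k ≤ 1 / (Fintype.card (S k) : ℝ) ^ 2 *
      ∑ i ∈ univ.filter (fun i => (𝓐 i).stage = k + 1),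
        ∑ i' ∈ univ.filter (fun i => (𝓐 i).stage = k + 1),
          nu S δ ((𝓐 i).F.erase k ∪ (𝓐 i').F.erase k) := by
  set T := univ.filter (fun i => (𝓐 i).stage = k + 1) with hT
  have hpoint (x : Qp S k) : alpha 𝓐 k x ^ 2 * w 𝓐 δ k x ≤
      1 / (Fintype.card (S k) : ℝ) ^ 2 * ∑ i ∈ T, ∑ i' ∈ T,
        if memH (𝓐 i) x ∧ memH (𝓐 i') x then w 𝓐 δ k x else 0 := by
    refine (mul_le_mul_of_nonneg_right (pow_le_pow_left₀ (alpha_nonneg k x)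
      (alpha_le hF k x) 2) (w_nonneg hδ hk.le x)).trans_eq ?_
    rw [div_pow, sq (∑ i ∈ _, _), sum_mul_sum, div_mul_eq_mul_div, sum_mul, one_div_mul_eq_div]
    congr 1
    refine sum_congr rfl fun i _ => ?_
    rw [sum_mul]
    refine sum_congr rfl fun i' _ => ?_
    by_cases h : memH (𝓐 i) x <;> by_cases h' : memH (𝓐 i') x <;> simp [h, h']
  refine (sum_le_sum fun x _ => hpoint x).trans ?_
  rw [← mul_sum, sum_comm]
  refine mul_le_mul_of_nonneg_left (sum_le_sum fun i hi => ?_) (by positivity)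
  rw [sum_comm]
  refine sum_le_sum fun i' hi' => ?_
  rw [← Hyp.filter_lt_of_stage_eq (mem_filter.1 hi).2,
    ← Hyp.filter_lt_of_stage_eq (mem_filter.1 hi').2, ← filter_union]
  exact sum_w_memH_inter_le hS hδ hk.le _ _

end Distortion

/-- **Corollary 2.**  Let `C₀ ≥ 0`.  If the hyperplanes of `𝒜` are pairwise
non-parallel and `‖F(A)‖ > C₀` for every `A ∈ 𝒜`, then for `1 ≤ k ≤ n`
(the paper's `k` is `k + 1` here, `k < n`) with `δ_k ∈ (0, 1/2]`:
`w_k(B_k) ≤ (1/(4 δ_k (1 - δ_k) |S_k|²))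
  ∑_{F₁,F₂ ⊆ {1,…,k-1}, ‖F₁‖ > C₀/|S_k|, ‖F₂‖ > C₀/|S_k|}
    ∏_{j ∈ F₁ ∪ F₂} 1 / ((1 - δ_j)|S_j|)`. -/
theorem wB_le_double_sum
    (S : ℕ → Type) [∀ j, Fintype (S j)] (n : ℕ) (hn : 0 < n)
    (hcard : ∀ j, j < n → 2 ≤ Fintype.card (S j))
    (δ : ℕ → ℝ) (hδ : ∀ j, j < n → δ j ∈ Set.Icc (0 : ℝ) (1 / 2))
    (ι : Type) [Fintype ι] (𝓐 : ι → Hyp S n)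
    (hFne : ∀ i, (𝓐 i).F.Nonempty)
    (hpar : ∀ i i', (𝓐 i).F = (𝓐 i').F → i = i')
    (C₀ : ℝ) (hC₀ : 0 ≤ C₀)
    (hnorm : ∀ i, C₀ < normJ S (𝓐 i).F)
    (k : ℕ) (hk : k < n) (hδk : 0 < δ k) :
    wB 𝓐 δ (k + 1) ≤ (1 / (4 * δ k * (1 - δ k) * (Fintype.card (S k) : ℝ) ^ 2)) *
      ∑ F₁ ∈ (Finset.range k).powerset.filter
          (fun J => C₀ / (Fintype.card (S k)) < normJ S J),
        ∑ F₂ ∈ (Finset.range k).powerset.filter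
            (fun J => C₀ / (Fintype.card (S k)) < normJ S J),
          ∏ j ∈ F₁ ∪ F₂, 1 / ((1 - δ j) * (Fintype.card (S j))) := by
  have hS (j : ℕ) (hj : j < n) : 0 < Fintype.card (S j) := by have := hcard j hj; omega
  have hSk : (0 : ℝ) < Fintype.card (S k) := by exact_mod_cast hS k hk
  have hδk' : 0 < 1 - δ k := by linarith [(hδ k hk).2]
  set T := univ.filter (fun i => (𝓐 i).stage = k + 1)
  set G := (Finset.range k).powerset.filter (fun J => C₀ / (Fintype.card (S k)) < normJ S J)
    with hG
  have hk_mem (i : ι) (hi : i ∈ T) : k ∈ (𝓐 i).F :=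
    Hyp.mem_F_of_stage_eq (hFne i) (mem_filter.1 hi).2
  have hinj : Set.InjOn (fun i => (𝓐 i).F.erase k) (T : Set ι) := by
    intro i hi i' hi' h
    apply hpar
    rw [← insert_erase (hk_mem i hi), ← insert_erase (hk_mem i' hi')]
    exact congrArg (insert k) h
  have himage : T.image (fun i => (𝓐 i).F.erase k) ⊆ G := by
    refine image_subset_iff.2 fun i hi => ?_
    rw [hG, mem_filter, mem_powerset]
    constructor
    · rw [← Hyp.filter_lt_of_stage_eq (mem_filter.1 hi).2]
      exact fun j hj => mem_range.2 (mem_filter.1 hj).2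
    · rw [div_lt_iff₀ hSk, normJ, prod_erase_mul _ _ (hk_mem i hi)]
      exact hnorm i
  have hreindex (f : Finset ℕ → ℝ) (hf : ∀ J ∈ G, 0 ≤ f J) :
      ∑ i ∈ T, f ((𝓐 i).F.erase k) ≤ ∑ J ∈ G, f J := by
    rw [← sum_image (f := f) hinj]
    exact sum_le_sum_of_subset_of_nonneg himage fun J hJ _ => hf J hJ
  have hnu (J J' : Finset ℕ) (hJ : J ∈ G) (hJ' : J' ∈ G) : 0 ≤ nu S δ (J ∪ J') := by
    refine prod_nonneg fun j hj => div_nonneg zero_le_one (mul_nonneg ?_ (by positivity))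
    have hjk : j < k := mem_range.1 <| union_subset (mem_powerset.1 (mem_filter.1 hJ).1)
      (mem_powerset.1 (mem_filter.1 hJ').1) hj
    linarith [(hδ j (hjk.trans hk)).2]
  calc wB 𝓐 δ (k + 1) ≤ 1 / (4 * δ k * (1 - δ k)) * Ew 𝓐 δ k := wB_le_Ew hδ hk (hS k hk) hδk
    _ ≤ 1 / (4 * δ k * (1 - δ k)) * (1 / (Fintype.card (S k) : ℝ) ^ 2 *
        ∑ J ∈ G, ∑ J' ∈ G, nu S δ (J ∪ J')) := by
      refine mul_le_mul_of_nonneg_left ((Ew_le hFne hS hδ hk).trans ?_) (by positivity)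
      refine mul_le_mul_of_nonneg_left ?_ (by positivity)
      refine le_trans (sum_le_sum fun i hi => hreindex (fun J' => nu S δ (_ ∪ J')) fun J' hJ' =>
        hnu _ _ (himage (mem_image_of_mem _ hi)) hJ') ?_
      exact hreindex (fun J => ∑ J' ∈ G, nu S δ (J ∪ J')) fun J hJ =>
        sum_nonneg fun J' hJ' => hnu J J' hJ hJ'
    _ = _ := by
      rw [← mul_assoc, one_div_mul_one_div]
      rfl
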